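/- A finite group G has an equal partition if and only if G is a non-cyclic p-group of exponent p for some prime p. -/

import Mathlib

/-- A covering of a group `G` is a finite collection of proper subgroups of `G`
whose set-theoretic union is all of `G`. -/
def IsCovering {G : Type*} [Group G] (C : Finset (Subgroup G)) : Prop :=
  (∀ H ∈ C, H ≠ (⊤ : Subgroup G)) ∧ ∀ g : G, ∃ H ∈ C, g ∈ H

/-- An equal partition of `G` is a covering in which all members have the same order
and any two distinct members intersect trivially. -/
def IsEqualPartition {G : Type*} [Group G] (C : Finset (Subgroup G)) : Prop :=
  IsCovering C ∧ (∀ H ∈ C, ∀ K ∈ C, Nat.card H = Nat.card K) ∧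
    ∀ H ∈ C, ∀ K ∈ C, H ≠ K → H ⊓ K = ⊥

/-- A map assigning to every `x` a subgroup containing it, such that the values at nontrivial
elements are the components of a partition of the group. -/
structure IsPartitionMap {G : Type*} [Group G] (A : G → Subgroup G) : Prop where
  mem : ∀ x, x ∈ A x
  eq_of_mem : ∀ x y, x ≠ 1 → y ≠ 1 → y ∈ A x → A y = A x

namespace IsPartitionMap

variable {G : Type*} [Group G] {A : G → Subgroup G}

theorem pow_orderOf_eq_one (hA : IsPartitionMap A) {x y : G} (hxy : Commute x y) (hx : x ≠ 1)
    (h : y ∉ A x) : x ^ orderOf y = 1 := by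
  by_contra hk
  have hpow : (x * y) ^ orderOf y = x ^ orderOf y := by
    rw [hxy.mul_pow, _root_.pow_orderOf_eq_one, mul_one]
  have hxy1 : x * y ≠ 1 := fun h1 => hk (by rw [← hpow, h1, one_pow])
  have h1 := hA.eq_of_mem _ _ hx hk (pow_mem (hA.mem x) _)
  have h2 := hA.eq_of_mem _ _ hxy1 hk (hpow ▸ pow_mem (hA.mem (x * y)) _)
  have h3 : x * y ∈ A x := h1 ▸ h2 ▸ hA.mem (x * y)
  exact h (((A x).mul_mem_cancel_left (hA.mem x)).1 h3)

/-- Commuting elements lying in different components have the same order. -/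
theorem orderOf_eq_of_commute (hA : IsPartitionMap A) {x y : G} (hxy : Commute x y) (hx : x ≠ 1)
    (hy : y ≠ 1) (h : y ∉ A x) : orderOf x = orderOf y := by
  have h' : x ∉ A y := fun hm => h (hA.eq_of_mem _ _ hy hx hm ▸ hA.mem y)
  exact Nat.dvd_antisymm (orderOf_dvd_of_pow_eq_one (hA.pow_orderOf_eq_one hxy hx h))
    (orderOf_dvd_of_pow_eq_one (hA.pow_orderOf_eq_one hxy.symm hy h'))

end IsPartitionMap

namespace IsEqualPartition

variable {G : Type*} [Group G] {C : Finset (Subgroup G)}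

theorem eq_of_mem (hC : IsEqualPartition C) {H K : Subgroup G} (hH : H ∈ C) (hK : K ∈ C) {x : G}
    (hx : x ≠ 1) (hxH : x ∈ H) (hxK : x ∈ K) : H = K := by
  by_contra hne
  have : x ∈ H ⊓ K := ⟨hxH, hxK⟩
  rw [hC.2.2 H hH K hK hne, Subgroup.mem_bot] at this
  exact hx this

theorem exists_isPartitionMap (hC : IsEqualPartition C) :
    ∃ c : G → Subgroup G, (∀ x, c x ∈ C) ∧ IsPartitionMap c := by
  choose c hc hm using hC.1.2
  exact ⟨c, hc, hm, fun x y hx hy h => hC.eq_of_mem (hc y) (hc x) hy (hm y) h⟩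

/-- The common component of `x` in all the conjugates of the covering `C`. -/
def core (C : Finset (Subgroup G)) (x : G) : Subgroup G where
  carrier := {y | ∀ g : G, ∀ H ∈ C, g * x * g⁻¹ ∈ H → g * y * g⁻¹ ∈ H}
  one_mem' := fun g H _ _ => by simp [H.one_mem]
  mul_mem' := fun {a b} ha hb g H hH hx => by
    have := H.mul_mem (ha g H hH hx) (hb g H hH hx)
    rwa [conj_mul] at this
  inv_mem' := fun {a} ha g H hH hx => by
    have := H.inv_mem (ha g H hH hx)
    rwa [conj_inv] at this

theorem mem_core_symm (hC : IsEqualPartition C) {x y : G} (hy : y ≠ 1)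
    (h : y ∈ core C x) : x ∈ core C y := by
  intro g H hH hyH
  obtain ⟨K, hK, hxK⟩ := hC.1.2 (g * x * g⁻¹)
  have hyK := h g K hK hxK
  have hne : g * y * g⁻¹ ≠ 1 := by simpa [conj_eq_one_iff] using hy
  rwa [hC.eq_of_mem hH hK hne hyH hyK]

theorem core_le (x y : G) (h : y ∈ core C x) : core C y ≤ core C x :=
  fun _ hz g H hH hx => hz g H hH (h g H hH hx)

theorem isPartitionMap_core (hC : IsEqualPartition C) : IsPartitionMap (core C) where
  mem _ _ _ _ h := h
  eq_of_mem x y _ hy h :=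
    le_antisymm (core_le x y h) (core_le y x (hC.mem_core_symm hy h))

theorem conj_mem_core_conj {x y g : G} : g * y * g⁻¹ ∈ core C (g * x * g⁻¹) ↔ y ∈ core C x := by
  constructor
  · intro h k H hH hx
    have := h (k * g⁻¹) H hH (by simpa [mul_assoc] using hx)
    simpa [mul_assoc] using this
  · intro h k H hH hx
    have := h (k * g) H hH (by simpa [mul_assoc] using hx)
    simpa [mul_assoc] using this

theorem mem_normalizer_core (hC : IsEqualPartition C) {x y g : G} (hx : x ≠ 1) (hy : y ≠ 1)
    (hyx : y ∈ core C x) (hg : g * y * g⁻¹ ∈ core C x) :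
    g ∈ Subgroup.normalizer (core C x : Set G) := by
  have hne : g * y * g⁻¹ ≠ 1 := by simpa [conj_eq_one_iff] using hy
  have h1 := hC.isPartitionMap_core.eq_of_mem _ _ hx hy hyx
  have h2 := hC.isPartitionMap_core.eq_of_mem _ _ hx hne hg
  rw [Subgroup.mem_normalizer_iff]
  intro z
  nth_rw 2 [← h2]
  rw [conj_mem_core_conj, h1]

open Classical in
theorem sum_card_inter (hC : IsEqualPartition C) (S : Finset G) (hS : 1 ∉ S) :
    ∑ H ∈ C, (S.filter (· ∈ H)).card = S.card := by
  simp_rw [Finset.card_filter]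
  rw [Finset.sum_comm, Finset.card_eq_sum_ones]
  refine Finset.sum_congr rfl fun x hx => ?_
  obtain ⟨H, hH, hxH⟩ := hC.1.2 x
  have hx1 : x ≠ 1 := fun h => hS (h ▸ hx)
  rw [Finset.sum_eq_single_of_mem H hH fun K hK hne => if_neg fun hxK =>
    hne (hC.eq_of_mem hK hH hx1 hxK hxH), if_pos hxH]

section Counting

variable [Finite G]

theorem one_lt_card (hC : IsEqualPartition C) {H : Subgroup G} (hH : H ∈ C) : 1 < Nat.card H := by
  by_contra! hle
  have h1 : Nat.card H = 1 := le_antisymm hle Nat.card_pos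
  refine hC.1.1 H hH (eq_top_iff.2 fun g _ => ?_)
  obtain ⟨K, hK, hgK⟩ := hC.1.2 g
  rw [Subgroup.card_eq_one.1 ((hC.2.1 K hK H hH).trans h1), Subgroup.mem_bot] at hgK
  exact hgK ▸ H.one_mem

theorem card_mul_pred (hC : IsEqualPartition C) {H : Subgroup G} (hH : H ∈ C) :
    C.card * (Nat.card H - 1) = Nat.card G - 1 := by
  classical
  have := Fintype.ofFinite G
  have h := hC.sum_card_inter (Finset.univ.erase 1) (by simp)
  rw [Finset.card_erase_of_mem (Finset.mem_univ _), Finset.card_univ,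
    ← Nat.card_eq_fintype_card] at h
  rw [← h, ← smul_eq_mul, ← Finset.sum_const]
  refine Finset.sum_congr rfl fun K hK => ?_
  rw [Finset.filter_erase, Finset.card_erase_of_mem (by simp [K.one_mem]), hC.2.1 H hH K hK,
    Nat.subtype_card (Finset.univ.filter (· ∈ K)) (by simp)]

theorem card_lt (hC : IsEqualPartition C) {H : Subgroup G} (hH : H ∈ C) :
    Nat.card H < Nat.card G :=
  lt_of_le_of_ne (Subgroup.card_le_card_group H) fun h =>
    hC.1.1 H hH (Subgroup.eq_top_of_card_eq H h)

/-- The order of the group is at least the square of the order of a component. -/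
theorem sq_card_le (hC : IsEqualPartition C) {H : Subgroup G} (hH : H ∈ C) :
    Nat.card H ^ 2 ≤ Nat.card G := by
  have h1 := hC.card_mul_pred hH
  have h2 := hC.one_lt_card hH
  have h3 := hC.card_lt hH
  obtain ⟨t, ht⟩ := Subgroup.card_subgroup_dvd_card H
  obtain ⟨k, hk⟩ := Nat.exists_eq_add_of_lt h2
  obtain ⟨s, rfl⟩ : ∃ s, t = s + 1 := by
    cases t with
    | zero => simp [ht] at h3
    | succ s => exact ⟨s, rfl⟩
  generalize Nat.card H = m at *
  subst hk
  rw [ht] at h1 h3 ⊢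
  have hs : s ≠ 0 := by rintro rfl; simp at h3
  have hd : k + 1 ∣ s := by
    have h4 : C.card * (k + 1) = (k + 1) * (s + 1) + s := by
      have : (1 + k + 1) * (s + 1) - 1 = (k + 1) * (s + 1) + s := by
        rw [Nat.sub_eq_iff_eq_add (Nat.mul_pos (by omega) (by omega))]; ring
      rw [← this, ← h1]; congr 1; omega
    exact (Nat.dvd_add_right (Dvd.intro _ rfl)).1 (h4 ▸ Dvd.intro_left _ rfl)
  have := Nat.le_of_dvd (Nat.pos_of_ne_zero hs) hd
  nlinarith

/-- No nontrivial element has conjugates in all the components. -/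
theorem exists_forall_conj_notMem (hC : IsEqualPartition C) {x : G} (hx : x ≠ 1) :
    ∃ H ∈ C, ∀ g : G, g * x * g⁻¹ ∉ H := by
  classical
  by_contra! hcon
  have := Fintype.ofFinite G
  obtain ⟨H, hH, -⟩ := hC.1.2 1
  have hle : ∀ K ∈ C, Nat.card H ≤ (Finset.univ.filter fun g : G => g * x * g⁻¹ ∈ K).card := by
    intro K hK
    obtain ⟨g, hg⟩ := hcon K hK
    rw [hC.2.1 H hH K hK, Nat.subtype_card (Finset.univ.filter (· ∈ K)) (by simp)]
    refine Finset.card_le_card_of_injOn (· * g) (fun k hk => ?_) fun a _ b _ h => by simpa using h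
    simp only [Finset.coe_filter, Finset.mem_univ, true_and, Set.mem_ofPred_eq] at hk ⊢
    have := K.mul_mem (K.mul_mem hk hg) (K.inv_mem hk)
    simpa [mul_assoc] using this
  have hsum : ∑ K ∈ C, (Finset.univ.filter fun g : G => g * x * g⁻¹ ∈ K).card = Nat.card G := by
    simp_rw [Finset.card_filter]
    rw [Finset.sum_comm, Nat.card_eq_fintype_card, ← Finset.card_univ, Finset.card_eq_sum_ones]
    refine Finset.sum_congr rfl fun g _ => ?_
    obtain ⟨K, hK, hgK⟩ := hC.1.2 (g * x * g⁻¹)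
    have hne : g * x * g⁻¹ ≠ 1 := by simpa [conj_eq_one_iff] using hx
    rw [Finset.sum_eq_single_of_mem K hK fun L hL hLK => if_neg fun hgL =>
      hLK (hC.eq_of_mem hL hK hne hgL hgK), if_pos hgK]
  have h1 : C.card * Nat.card H ≤ Nat.card G := by
    rw [← hsum, ← smul_eq_mul, ← Finset.sum_const]
    exact Finset.sum_le_sum hle
  have h2 := hC.card_mul_pred hH
  have h3 := hC.one_lt_card hH
  have h4 := hC.card_lt hH
  rw [Nat.mul_sub, mul_one] at h2
  have h5 : C.card ≤ C.card * Nat.card H := Nat.le_mul_of_pos_right _ (by omega)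
  have h6 : C.card ≤ 1 := by omega
  have h7 : C.card * (Nat.card H) ≤ Nat.card H := by nlinarith
  have h8 := Finset.card_pos.2 ⟨H, hH⟩
  omega

end Counting

end IsEqualPartition

theorem Nat.exists_prime_two_mul_factorization_le {m n : ℕ} (hm : 1 < m) (hmn : m ∣ n)
    (hsq : m ^ 2 ≤ n) (hp : ∀ p : ℕ, p.Prime → p ∣ n → p ∣ m) :
    ∃ p : ℕ, p.Prime ∧ p ∣ m ∧ 2 * m.factorization p ≤ n.factorization p := by
  by_contra! hcon
  obtain ⟨t, rfl⟩ := hmn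
  have hm0 : m ≠ 0 := by omega
  have hmt : m ≤ t := Nat.le_of_mul_le_mul_left (by rwa [← sq]) (by omega : 0 < m)
  have ht0 : t ≠ 0 := by omega
  have hdvd : t ∣ m := by
    rw [← Nat.factorization_prime_le_iff_dvd ht0 hm0]
    intro p hpp
    by_cases hpt : p ∣ t
    · have := hcon p hpp (hp p hpp (hpt.mul_left m))
      rw [Nat.factorization_mul hm0 ht0, Finsupp.add_apply] at this
      omega
    · simp [Nat.factorization_eq_zero_of_not_dvd hpt]
  obtain rfl : t = m := le_antisymm (Nat.le_of_dvd (by omega) hdvd) hmt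
  have hmin := Nat.minFac_prime hm.ne'
  have := hcon _ hmin (Nat.minFac_dvd t)
  rw [Nat.factorization_mul hm0 ht0, Finsupp.add_apply] at this
  omega

theorem Subgroup.card_lt_sq_of_conj_mem {P : Type*} [Group P] [Finite P] (D : Subgroup P) {x : P}
    (hx : x ≠ 1) (hconj : ∀ g, g * x * g⁻¹ ∈ D) (hcomm : ∀ u, Commute u x → u ∈ D) :
    Nat.card P < Nat.card D ^ 2 := by
  have h1 : (MulAction.orbit (ConjAct P) x) ⊆ (D : Set P) \ {1} := by
    rintro _ ⟨g, rfl⟩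
    simp only [ConjAct.smul_def]
    exact ⟨hconj _, by simpa [conj_eq_one_iff] using hx⟩
  have h2 := Set.ncard_le_ncard h1
  rw [Set.ncard_sdiff_singleton_of_mem D.one_mem, ← MulAction.index_stabilizer,
    ← Nat.card_coe_set_eq] at h2
  have h3 : Nat.card (MulAction.stabilizer (ConjAct P) x) ≤ Nat.card D := by
    refine Nat.card_le_card_of_injective (fun g => ⟨ConjAct.ofConjAct g.1, hcomm _ ?_⟩) ?_
    · have := g.2
      rw [MulAction.mem_stabilizer_iff, ConjAct.smul_def, mul_inv_eq_iff_eq_mul] at this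
      exact this
    · intro a b h
      simpa using h
  have h4 := (MulAction.stabilizer (ConjAct P) x).index_mul_card
  have h5 : Nat.card (ConjAct P) = Nat.card P := Nat.card_congr ConjAct.ofConjAct.toEquiv
  have h6 : 0 < Nat.card D := Nat.card_pos
  rw [← h5, ← h4]
  calc _ ≤ (Nat.card D - 1) * Nat.card D := Nat.mul_le_mul h2 h3
    _ < Nat.card D ^ 2 := by
      rw [sq]
      exact Nat.mul_lt_mul_of_pos_right (by omega) h6

theorem IsPGroup.card_dvd_pow_factorization {p : ℕ} [Fact p.Prime] {D : Type*} [Group D] [Finite D]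
    (hD : IsPGroup p D) {m : ℕ} (hm : m ≠ 0) (h : Nat.card D ∣ m) :
    Nat.card D ∣ p ^ m.factorization p := by
  obtain ⟨d, hd⟩ := IsPGroup.iff_card.1 hD
  rw [hd] at h ⊢
  exact pow_dvd_pow _ (((Fact.out : p.Prime).pow_dvd_iff_le_factorization hm).1 h)

/-- If the `p`-part of the order of the components of an equal partition is small, then the
`p`-elements have order at most `p`. -/
theorem IsEqualPartition.pow_eq_one {G : Type*} [Group G] [Finite G] {C : Finset (Subgroup G)}
    (hC : IsEqualPartition C) {p : ℕ} [hp : Fact p.Prime] {H : Subgroup G} (hH : H ∈ C)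
    (hgood : 2 * (Nat.card H).factorization p ≤ (Nat.card G).factorization p) {x : G}
    {k : ℕ} (hx : x ^ p ^ k = 1) : x ^ p = 1 := by
  by_contra hxp
  obtain ⟨c, hc, hcp⟩ := hC.exists_isPartitionMap
  have hne : ∀ u : G, u ^ p ≠ 1 → u ≠ 1 := by rintro u hu rfl; simp at hu
  have hzp : IsPGroup p (Subgroup.zpowers x) := by
    rintro ⟨_, j, rfl⟩
    refine ⟨k, Subtype.ext ?_⟩
    rw [Subgroup.coe_pow, ← zpow_natCast, ← zpow_mul, mul_comm, zpow_mul, zpow_natCast]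
    simp [hx]
  obtain ⟨P, hP⟩ := hzp.exists_le_sylow
  have hxP : x ∈ (P : Subgroup G) := hP (Subgroup.mem_zpowers x)
  have hord : ∀ u ∈ (P : Subgroup G), u ^ p ≠ 1 → orderOf u ≠ orderOf (u ^ p) := by
    intro u hu hup
    have hdvd : p ∣ orderOf u := by
      obtain ⟨j, hj⟩ := P.isPGroup' ⟨u, hu⟩
      have hj' : u ^ p ^ j = 1 := by simpa using congrArg Subtype.val hj
      obtain ⟨i, -, hi⟩ := (Nat.dvd_prime_pow hp.out).1 (orderOf_dvd_of_pow_eq_one hj')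
      rw [hi]
      refine dvd_pow_self p ?_
      rintro rfl
      exact hne u hup (orderOf_eq_one_iff.1 (by simpa using hi))
    rw [orderOf_pow_of_dvd hp.out.ne_zero hdvd]
    exact (Nat.div_lt_self (orderOf_pos u) hp.out.one_lt).ne'
  have hcomm : ∀ u ∈ (P : Subgroup G), u ^ p ≠ 1 → ∀ v, v ≠ 1 → Commute u v → v ∈ c u := by
    intro u hu hup v hv huv
    by_contra hvu
    have h1 := hcp.orderOf_eq_of_commute huv (hne u hup) hv hvu
    have h2 := hcp.eq_of_mem _ _ (hne u hup) hup (pow_mem (hcp.mem u) p)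
    have h3 := hcp.orderOf_eq_of_commute (huv.pow_left p) hup hv (h2 ▸ hvu)
    exact hord u hu hup (h1.trans h3.symm)
  have : Nontrivial P := ⟨⟨⟨x, hxP⟩, 1, fun h => hne x hxp (congrArg Subtype.val h)⟩⟩
  have := P.isPGroup'.center_nontrivial
  obtain ⟨⟨z, hz⟩, hz1⟩ := exists_ne (1 : Subgroup.center P)
  have hz1' : (z : G) ≠ 1 := fun h => hz1 (Subtype.ext (Subtype.ext h))
  have hzcomm : ∀ u ∈ (P : Subgroup G), Commute u z := fun u hu =>
    congrArg Subtype.val (Subgroup.mem_center_iff.1 hz ⟨u, hu⟩)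
  have hmem : ∀ u ∈ (P : Subgroup G), u ^ p ≠ 1 → c u = c z := fun u hu hup =>
    (hcp.eq_of_mem _ _ (hne u hup) hz1' (hcomm u hu hup z hz1' (hzcomm u hu))).symm
  have hlt := ((c z).subgroupOf P).card_lt_sq_of_conj_mem (x := ⟨x, hxP⟩)
    (fun h => hne x hxp (congrArg Subtype.val h)) (fun g => by
      rw [Subgroup.mem_subgroupOf, ← hmem _ (SetLike.coe_mem _) ?_]
      · exact hcp.mem _
      · simpa [conj_pow, conj_eq_one_iff] using hxp) (fun u hu => by
      rw [Subgroup.mem_subgroupOf, ← hmem x hxP hxp]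
      by_cases hu1 : (u : G) = 1
      · rw [hu1]; exact one_mem _
      · exact hcomm x hxP hxp u hu1 (congrArg Subtype.val hu.symm.eq))
  have hdvd := (P.isPGroup'.to_subgroup ((c z).subgroupOf P)).card_dvd_pow_factorization
    (m := Nat.card H) Nat.card_pos.ne' (by
      rw [hC.2.1 H hH _ (hc z)]
      exact Subgroup.card_comap_dvd_of_injective _ _ P.1.subtype_injective)
  have hle := Nat.pow_le_pow_left (Nat.le_of_dvd (pow_pos hp.out.pos _) hdvd) 2
  rw [← pow_mul, mul_comm] at hle
  have := hlt.trans_le (hle.trans (Nat.pow_le_pow_right hp.out.pos hgood))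
  exact this.ne P.card_eq_multiplicity

theorem dvd_natCard_of_conj_mem {H : Type*} [Group H] [Finite H] {S : Set H}
    (hS : ∀ g, ∀ x ∈ S, g * x * g⁻¹ ∈ S) {d : ℕ} (hd : d ∣ Nat.card H)
    (hcomm : ∀ q : ℕ, q.Prime → q ∣ d → ∀ x ∈ S, ∀ y, orderOf y = q → ¬Commute x y) :
    d ∣ Nat.card S := by
  classical
  let T : SubMulAction (ConjAct H) H :=
    { carrier := S
      smul_mem' := fun g x hx => by rw [ConjAct.smul_def]; exact hS _ x hx }
  change d ∣ Nat.card T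
  have : Finite (ConjAct H) := ‹Finite H›
  have hH : Nat.card (ConjAct H) = Nat.card H := Nat.card_congr ConjAct.ofConjAct.toEquiv
  have := Fintype.ofFinite (MulAction.orbitRel.Quotient (ConjAct H) T)
  rw [Nat.card_congr (MulAction.selfEquivSigmaOrbits (ConjAct H) T), Nat.card_sigma]
  refine Finset.dvd_sum fun ω _ => ?_
  set t : T := ω.out
  rw [Nat.card_coe_set_eq, ← MulAction.index_stabilizer]
  refine Nat.Coprime.dvd_of_dvd_mul_right (n := Nat.card (MulAction.stabilizer (ConjAct H) t)) ?_ ?_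
  · refine Nat.coprime_of_dvd fun q hq hqd hqs => ?_
    have : Fact q.Prime := ⟨hq⟩
    obtain ⟨y, hy⟩ := exists_prime_orderOf_dvd_card' q hqs
    refine hcomm q hq hqd t t.2 (ConjAct.ofConjAct y.1) ?_ ?_
    · rw [MulEquiv.orderOf_eq, Subgroup.orderOf_coe, hy]
    · have h1 := congrArg Subtype.val (MulAction.mem_stabilizer_iff.1 y.2)
      rw [SubMulAction.val_smul, ConjAct.smul_def, mul_inv_eq_iff_eq_mul] at h1
      exact h1.symm
  · rw [Subgroup.index_mul_card, hH]
    exact hd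

open Classical in
theorem Subgroup.dvd_card_filter_of_conj_mem {G : Type*} [Group G] [Finite G] (H : Subgroup G)
    {S : Finset G} (hS : ∀ g, ∀ x ∈ S, g * x * g⁻¹ ∈ S) {d : ℕ} (hd : d ∣ Nat.card H)
    (hcomm : ∀ q : ℕ, q.Prime → q ∣ d → ∀ x ∈ S, ∀ y, orderOf y = q → ¬Commute x y) :
    d ∣ (S.filter (· ∈ H)).card := by
  have h := dvd_natCard_of_conj_mem (S := {x : H | (x : G) ∈ S}) (fun g x hx => hS g x hx) hd
    fun q hq hqd x hx y hy hxy => hcomm q hq hqd x hx y (by rw [Subgroup.orderOf_coe, hy])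
      (congrArg Subtype.val hxy.eq)
  have hcard : Nat.card {x : G // x ∈ H ∧ x ∈ S} = (S.filter (· ∈ H)).card :=
    Nat.subtype_card _ (by simp [and_comm])
  rw [← hcard]
  exact (Nat.card_congr (Equiv.subtypeSubtypeEquivSubtypeInter (· ∈ H) (· ∈ S))) ▸ h

theorem IsEqualPartition.isPGroup {G : Type*} [Group G] [Finite G] {C : Finset (Subgroup G)}
    (hC : IsEqualPartition C) {p : ℕ} [hp : Fact p.Prime] (hpG : p ∣ Nat.card G)
    (hexp : ∀ (x : G) (k : ℕ), x ^ p ^ k = 1 → x ^ p = 1)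
    (hcomm : ∀ x y : G, ∀ q : ℕ, q.Prime → Commute x y → orderOf x = p → orderOf y = q → q = p) :
    IsPGroup p G := by
  classical
  by_contra hnp
  have := Fintype.ofFinite G
  obtain ⟨H, hH, -⟩ := hC.1.2 1
  set m := Nat.card H with hm
  set n := Nat.card G with hn
  have hn0 : n ≠ 0 := Nat.card_pos.ne'
  have hm0 : m ≠ 0 := Nat.card_pos.ne'
  have hmK : ∀ K ∈ C, Nat.card K = m := fun K hK => hC.2.1 K hK H hH
  let S : Finset G := Finset.univ.filter fun x => orderOf x = p
  let S' : Finset G := Finset.univ.filter fun x => x ≠ 1 ∧ orderOf x ≠ p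
  have hconj : ∀ g x : G, orderOf (g * x * g⁻¹) = orderOf x := fun g x =>
    (MulAut.conj g).orderOf_eq x
  have hconj1 : ∀ g x : G, g * x * g⁻¹ = 1 ↔ x = 1 := fun g x => conj_eq_one_iff
  have hS : ∀ (d : ℕ) (K : Subgroup G), d ∣ Nat.card K → ¬p ∣ d → d ∣ (S.filter (· ∈ K)).card := by
    intro d K hd hpd
    refine K.dvd_card_filter_of_conj_mem (by simp [S, hconj]) hd fun q hq hqd x hx y hy hxy => ?_
    exact hpd (hcomm x y q hq hxy (Finset.mem_filter.1 hx).2 hy ▸ hqd)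
  have hS' : ∀ (k : ℕ) (K : Subgroup G), p ^ k ∣ Nat.card K →
      p ^ k ∣ (S'.filter (· ∈ K)).card := by
    intro k K hd
    refine K.dvd_card_filter_of_conj_mem (by simp [S', hconj, hconj1]) hd
      fun q hq hqd x hx y hy hxy => ?_
    obtain rfl := (Nat.prime_dvd_prime_iff_eq hq hp.out).1 (hq.dvd_of_dvd_pow hqd)
    obtain ⟨-, hx1, hxo⟩ := Finset.mem_filter.1 hx
    have hox := (orderOf_pos x).ne'
    obtain ⟨r, hr, hrx, hrq⟩ : ∃ r : ℕ, r.Prime ∧ r ∣ orderOf x ∧ r ≠ q := by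
      by_contra! hcon
      have h1 := Nat.eq_prime_pow_of_unique_prime_dvd hox (fun {d} hd hdx => hcon d hd hdx)
      exact hxo (orderOf_eq_prime (hexp x _ (h1 ▸ pow_orderOf_eq_one x)) hx1)
    refine hrq (hcomm y (x ^ (orderOf x / r)) r hr (hxy.symm.pow_right _) hy ?_)
    rw [orderOf_pow_of_dvd (Nat.div_pos (Nat.le_of_dvd (orderOf_pos x) hrx) hr.pos).ne'
      (Nat.div_dvd_of_dvd hrx), Nat.div_div_self hrx hox]
  have hadd : ∀ K ∈ C, (S.filter (· ∈ K)).card + (S'.filter (· ∈ K)).card + 1 = m := by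
    intro K hK
    rw [← Finset.card_union_of_disjoint, ← hmK K hK,
      Nat.subtype_card (Finset.univ.filter (· ∈ K)) (by simp),
      ← Finset.card_insert_of_notMem (a := 1)]
    · congr 1
      ext x
      by_cases hx : x = 1
      · simp [hx, K.one_mem]
      · simp only [S, S', Finset.mem_insert, Finset.mem_union, Finset.mem_filter, Finset.mem_univ]
        tauto
    · simp [S, S', hp.out.one_lt.ne]
    · refine Finset.disjoint_left.2 fun x hx hx' => ?_
      simp only [S, S', Finset.mem_filter] at hx hx'
      exact hx'.1.2.2 hx.1.2
  have hconst : ∀ K ∈ C, (S.filter (· ∈ K)).card = (S.filter (· ∈ H)).card := by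
    intro K hK
    have hK' := hadd K hK
    have hH' := hadd H hH
    refine Nat.ModEq.eq_of_lt_of_lt (m := m) ?_ (by omega) (by omega)
    have hcop : Nat.Coprime (p ^ m.factorization p) (m / p ^ m.factorization p) :=
      (Nat.coprime_ordCompl hp.out hm0).pow_left _
    rw [← Nat.ordProj_mul_ordCompl_eq_self m p, ← Nat.modEq_and_modEq_iff_modEq_mul hcop]
    constructor
    · have h1 := hS' (m.factorization p) K (hmK K hK ▸ Nat.ordProj_dvd m p)
      have h2 := hS' (m.factorization p) H (Nat.ordProj_dvd m p)
      refine Nat.ModEq.add_right_cancel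
        (((Nat.modEq_zero_iff_dvd.2 h1).trans (Nat.modEq_zero_iff_dvd.2 h2).symm).add_right 1) ?_
      rw [← add_assoc, ← add_assoc, hK', hH']
    · have hnd := Nat.not_dvd_ordCompl hp.out hm0
      exact (Nat.modEq_zero_iff_dvd.2 (hS _ K (hmK K hK ▸ Nat.ordCompl_dvd m p) hnd)).trans
        (Nat.modEq_zero_iff_dvd.2 (hS _ H (Nat.ordCompl_dvd m p) hnd)).symm
  have hconst' : ∀ K ∈ C, (S'.filter (· ∈ K)).card = (S'.filter (· ∈ H)).card := by
    intro K hK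
    have h1 := hadd K hK
    have h2 := hadd H hH
    have h3 := hconst K hK
    omega
  have hsum := hC.sum_card_inter S (by simp [S, hp.out.one_lt.ne])
  have hsum' := hC.sum_card_inter S' (by simp [S'])
  rw [Finset.sum_congr rfl hconst, Finset.sum_const, smul_eq_mul] at hsum
  rw [Finset.sum_congr rfl hconst', Finset.sum_const, smul_eq_mul] at hsum'
  have hcop : Nat.Coprime n C.card := by
    have h1 := hC.card_mul_pred hH
    have h2 : Nat.Coprime n (n - 1) := (Nat.coprime_self_sub_right (by omega)).2 (by simp)
    exact h2.coprime_dvd_right (h1 ▸ Dvd.intro _ rfl)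
  have htop : Nat.card (⊤ : Subgroup G) = n := Subgroup.card_top
  have hd := hS (n / p ^ n.factorization p) ⊤ (htop ▸ Nat.ordCompl_dvd n p)
    (Nat.not_dvd_ordCompl hp.out hn0)
  have hd' := hS' (n.factorization p) ⊤ (htop ▸ Nat.ordProj_dvd n p)
  simp only [Subgroup.mem_top, Finset.filter_true] at hd hd'
  rw [← hsum] at hd
  rw [← hsum'] at hd'
  replace hd := (hcop.coprime_dvd_left (Nat.ordCompl_dvd n p)).dvd_of_dvd_mul_left hd
  replace hd' := (hcop.coprime_dvd_left (Nat.ordProj_dvd n p)).dvd_of_dvd_mul_left hd'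
  have hpos : 0 < (S.filter (· ∈ H)).card := by
    obtain ⟨x, hx⟩ := exists_prime_orderOf_dvd_card' p hpG
    obtain ⟨K, hK, hxK⟩ := hC.1.2 x
    rw [← hconst K hK, Finset.card_pos]
    exact ⟨x, by simp [S, hx, hxK]⟩
  have hpos' : 0 < (S'.filter (· ∈ H)).card := by
    obtain ⟨q, hq, hqn, hqp⟩ : ∃ q : ℕ, q.Prime ∧ q ∣ n ∧ q ≠ p := by
      by_contra! hcon
      exact hnp (IsPGroup.of_card (Nat.eq_prime_pow_of_unique_prime_dvd hn0
        (fun {d} hd hdx => hcon d hd hdx)))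
    have : Fact q.Prime := ⟨hq⟩
    obtain ⟨x, hx⟩ := exists_prime_orderOf_dvd_card' q hqn
    obtain ⟨K, hK, hxK⟩ := hC.1.2 x
    rw [← hconst' K hK, Finset.card_pos]
    have hx1 : x ≠ 1 := fun h => hq.one_lt.ne (by rw [← hx, h, orderOf_one])
    exact ⟨x, by simp [S', hx, hxK, hqp, hx1]⟩
  have hle := Nat.mul_le_mul (Nat.le_of_dvd hpos' hd') (Nat.le_of_dvd hpos hd)
  rw [Nat.ordProj_mul_ordCompl_eq_self] at hle
  have h1 := hadd H hH
  have h2 := hC.sq_card_le hH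
  rw [← hm, ← hn, ← h1] at h2
  nlinarith

/-- If the elements outside a proper normal subgroup `K` of a group of exponent `p` act without
nontrivial fixed points on an abelian group of order coprime to `|K|`, then `K` acts trivially. -/
theorem MulAut.apply_eq_of_forall_notMem {Y V : Type*} [Group Y] [Group V] [Finite V]
    (hV : ∀ a b : V, a * b = b * a) {p : ℕ} [hp : Fact p.Prime] (hexp : ∀ y : Y, y ^ p = 1)
    (φ : Y →* MulAut V) (K : Subgroup Y) [K.Normal] [Finite K] (hK : K ≠ ⊤)
    (hfix : ∀ y ∉ K, ∀ v, φ y v = v → v = 1) (hcop : Nat.Coprime (Nat.card V) (Nat.card K)) {k : Y}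
    (hk : k ∈ K) (v : V) : φ k v = v := by
  let _ : CommGroup V := { ‹Group V› with mul_comm := hV }
  have := Fintype.ofFinite K
  obtain ⟨c, hc⟩ : ∃ c, c ∉ K := by
    by_contra! h
    exact hK (eq_top_iff.2 fun y _ => h y)
  have hnorm : ∀ y ∉ K, ∀ v, ∏ i ∈ Finset.range p, φ (y ^ i) v = 1 := by
    intro y hy v
    refine hfix y hy _ ?_
    have h1 : φ y (∏ i ∈ Finset.range p, φ (y ^ i) v) =
        ∏ i ∈ Finset.range p, φ (y ^ (i + 1)) v := by
      rw [map_prod]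
      refine Finset.prod_congr rfl fun i _ => ?_
      rw [pow_succ', map_mul, MulAut.mul_apply]
    rw [h1]
    obtain ⟨n, hn⟩ := Nat.exists_eq_add_of_lt hp.out.pos
    rw [zero_add] at hn
    have hy1 := hexp y
    rw [hn] at hy1 ⊢
    rw [Finset.prod_range_succ, Finset.prod_range_succ' (fun i => φ (y ^ i) v), hy1, pow_zero]
  let T : ℕ → V → V := fun i v => ∏ b : K, φ ((c * b) ^ i) v
  have hT : ∀ v, ∏ i ∈ Finset.range p, T i v = 1 := by
    intro v
    rw [Finset.prod_comm]
    refine Finset.prod_eq_one fun b _ => hnorm _ (fun h => hc ?_) v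
    exact (K.mul_mem_cancel_right b.2).1 h
  have hmem : ∀ (i : ℕ) (b : K), (c ^ i)⁻¹ * (c * b) ^ i ∈ K := by
    intro i b
    rw [← QuotientGroup.eq, QuotientGroup.mk_pow, QuotientGroup.mk_pow,
      QuotientGroup.mk_mul_of_mem c b.2]
  have hTfix : ∀ i, i ≠ 0 → i < p → φ k (T i v) = T i v := by
    intro i hi0 hip
    have hinj : Function.Injective fun b : K => (⟨_, hmem i b⟩ : K) := by
      intro a b hab
      have h1 : (c * a) ^ i = (c * b) ^ i := by simpa using congrArg Subtype.val hab
      have hip' : Nat.Coprime i p := ((Nat.Prime.coprime_iff_not_dvd hp.out).2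
        (Nat.not_dvd_of_pos_of_lt (Nat.pos_of_ne_zero hi0) hip)).symm
      obtain ⟨j, -, hj⟩ := Nat.exists_mul_mod_eq_one_of_coprime hip' hp.out.one_lt
      have hroot : ∀ y : Y, (y ^ i) ^ j = y := fun y => by
        rw [← pow_mul, pow_eq_pow_mod _ (hexp y), hj, pow_one]
      have h2 := congrArg (· ^ j) h1
      simp only [hroot] at h2
      exact Subtype.ext (mul_left_cancel h2)
    have hbij := Finite.injective_iff_bijective.1 hinj
    have h1 : T i v = ∏ b : K, φ (c ^ i * b) v := by
      rw [← hbij.prod_comp fun b : K => φ (c ^ i * b) v]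
      simp [T]
    rw [h1, map_prod]
    let k' : K := ⟨(c ^ i)⁻¹ * k * c ^ i, by
      simpa using Subgroup.Normal.conj_mem ‹K.Normal› k hk (c ^ i)⁻¹⟩
    rw [← (Equiv.mulLeft k').bijective.prod_comp fun b : K => φ (c ^ i * b) v]
    refine Finset.prod_congr rfl fun b _ => ?_
    rw [← MulAut.mul_apply, ← map_mul]
    simp [k', mul_assoc]
  have hpow : φ k (v ^ Nat.card K) = v ^ Nat.card K := by
    obtain ⟨n, hn⟩ := Nat.exists_eq_add_of_lt hp.out.pos
    have h1 := hT v
    rw [hn, zero_add, Finset.prod_range_succ'] at h1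
    have h0 : T 0 v = v ^ Nat.card K := by simp [T, Nat.card_eq_fintype_card]
    rw [h0, mul_eq_one_iff_eq_inv'] at h1
    rw [h1, map_inv, map_prod]
    congr 1
    exact Finset.prod_congr rfl fun i hi => hTfix _ (by omega)
      (by rw [Finset.mem_range] at hi; omega)
  rw [map_pow] at hpow
  exact (powCoprime hcop).injective hpow

theorem Sylow.pow_dvd_relIndex {N : Type*} [Group N] [Finite N] {l : ℕ} [hl : Fact l.Prime]
    (T : Sylow l N) (B : Subgroup N) {k : ℕ} (h : l ^ k ∣ B.index) : l ^ k ∣ B.relIndex T := by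
  have h1 : B.index ∣ B.relIndex T * (T : Subgroup N).index := by
    rw [← Subgroup.inf_relIndex_right, Subgroup.relIndex_mul_index inf_le_right]
    exact Subgroup.index_dvd_of_le inf_le_left
  exact (((Nat.Prime.coprime_iff_not_dvd hl.out).2 T.not_dvd_index).pow_left k).dvd_of_dvd_mul_right
    (h.trans h1)

theorem Sylow.exists_le_normalizer_pow_dvd_relIndex {M : Type*} [Group M] [Finite M]
    {A : Subgroup M} [A.Normal] {r : ℕ} [Fact r.Prime] (R : Sylow r A) (l : ℕ) [Fact l.Prime] :
    ∃ T : Subgroup M, IsPGroup l T ∧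
      T ≤ Subgroup.normalizer ((R : Subgroup A).map A.subtype : Set M) ∧
      ∀ k, l ^ k ∣ A.index → l ^ k ∣ A.relIndex T := by
  set N := Subgroup.normalizer ((R : Subgroup A).map A.subtype : Set M)
  have hN : N ⊔ A = ⊤ := R.normalizer_sup_eq_top
  obtain ⟨T⟩ : Nonempty (Sylow l N) := inferInstance
  refine ⟨(T : Subgroup N).map N.subtype, T.isPGroup'.map _, ?_, fun k hk => ?_⟩
  · rintro _ ⟨t, -, rfl⟩
    exact t.2
  · rw [← Subgroup.relIndex_comap]
    refine T.pow_dvd_relIndex _ ?_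
    have : (A.subgroupOf N).index = A.index := by
      rw [← Subgroup.relIndex_top_right A, ← hN, Subgroup.relIndex_sup_right]; rfl
    rwa [← Subgroup.subgroupOf, this]

theorem Sylow.pow_factorization_dvd_card_inf {M : Type*} [Group M] [Finite M] (A : Subgroup M)
    [A.Normal] {l : ℕ} [hl : Fact l.Prime] (S : Sylow l M) :
    l ^ (Nat.card A).factorization l ∣ Nat.card (A ⊓ S : Subgroup M) := by
  have h1 : A.relIndex S * Nat.card (A ⊓ S : Subgroup M) = Nat.card S := by
    rw [← (A.subgroupOf S).index_mul_card, ← Subgroup.relIndex, ← Subgroup.inf_subgroupOf_right,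
      Nat.card_congr (Subgroup.subgroupOfEquivOfLe inf_le_right).toEquiv]
  obtain ⟨i, -, hi⟩ := (Nat.dvd_prime_pow hl.out).1
    (S.card_eq_multiplicity ▸ Dvd.intro _ h1 : A.relIndex S ∣ l ^ _)
  have h2 : i ≤ A.index.factorization l :=
    (hl.out.pow_dvd_iff_le_factorization A.index_ne_zero_of_finite).1
      (hi ▸ Subgroup.relIndex_dvd_index_of_normal _ _)
  rw [S.card_eq_multiplicity, ← A.index_mul_card,
    Nat.factorization_mul A.index_ne_zero_of_finite Nat.card_pos.ne', Finsupp.add_apply, hi] at h1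
  obtain ⟨e, he⟩ := Nat.exists_eq_add_of_le h2
  rw [he, add_assoc, pow_add] at h1
  rw [Nat.eq_of_mul_eq_mul_left (pow_pos hl.out.pos i) h1, add_comm, pow_add]
  exact Dvd.intro _ rfl

theorem Subgroup.normalizer_le_normalizer_inf_centralizer {M : Type*} [Group M] (R : Subgroup M) :
    Subgroup.normalizer (R : Set M) ≤
      Subgroup.normalizer ((R ⊓ Subgroup.centralizer R : Subgroup M) : Set M) := by
  rw [Subgroup.le_normalizer_iff]
  rintro g hg v ⟨hv, hvc⟩
  refine ⟨(Subgroup.mem_normalizer_iff.1 hg v).1 hv, Subgroup.mem_centralizer_iff.2 fun r hr => ?_⟩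
  have h1 := (Subgroup.mem_normalizer_iff''.1 hg r).1 hr
  have h2 := Subgroup.mem_centralizer_iff.1 hvc _ h1
  calc r * (g * v * g⁻¹) = g * (g⁻¹ * r * g * v) * g⁻¹ := by group
    _ = g * v * g⁻¹ * r := by rw [h2]; group

theorem Subgroup.exists_normal_lt {Y : Type*} [Group Y] [Finite Y] {p : ℕ} [hp : Fact p.Prime]
    (hY : IsPGroup p Y) {B : Subgroup Y} (hB : p ^ 2 ∣ B.index) :
    ∃ K : Subgroup Y, K.Normal ∧ B < K ∧ K ≠ ⊤ := by
  obtain ⟨b, hb⟩ := IsPGroup.iff_card.1 (hY.to_subgroup B)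
  obtain ⟨n, hn⟩ := IsPGroup.iff_card.1 hY
  have hle : b + 2 ≤ n := by
    rw [← Nat.pow_dvd_pow_iff_le_right hp.out.one_lt, ← hn, ← B.card_mul_index, hb, pow_add]
    exact mul_dvd_mul_left _ hB
  obtain ⟨k, rfl⟩ := Nat.exists_eq_add_of_le hle
  obtain ⟨K, hK, hBK⟩ := Sylow.exists_subgroup_card_pow_prime_le p
    (hn ▸ pow_dvd_pow p (by omega : b + 1 + k ≤ b + 2 + k)) B hb (by omega)
  have hidx : K.index = p := by
    have h1 := K.card_mul_index
    rw [hK, hn, show b + 2 + k = (b + 1 + k) + 1 by omega, pow_succ p (b + 1 + k)] at h1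
    exact Nat.eq_of_mul_eq_mul_left (pow_pos hp.out.pos _) h1
  refine ⟨K, Subgroup.normal_of_index_eq_minFac_card ?_, lt_of_le_of_ne hBK ?_, ?_⟩
  · rw [hidx, hn, hp.out.pow_minFac (by omega)]
  · rintro rfl
    rw [hb] at hK
    have := Nat.pow_right_injective hp.out.two_le hK
    omega
  · rintro rfl
    rw [Subgroup.index_top] at hidx
    exact hp.out.one_lt.ne hidx

theorem IsPGroup.orderOf_ne {M : Type*} [Group M] {p q : ℕ} [hp : Fact p.Prime] [hq : Fact q.Prime]
    (hpq : p ≠ q) {T R : Subgroup M} (hT : IsPGroup p T) (hR : IsPGroup q R) {x y : M}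
    (hx : x ∈ T) (hy : y ∈ R) (hy1 : y ≠ 1) : orderOf x ≠ orderOf y := by
  intro h
  obtain ⟨k, hk⟩ := hT ⟨x, hx⟩
  obtain ⟨j, hj⟩ := hR ⟨y, hy⟩
  have h1 : orderOf y ∣ p ^ k := h ▸ orderOf_dvd_of_pow_eq_one (congrArg Subtype.val hk)
  have h2 : orderOf y ∣ q ^ j := orderOf_dvd_of_pow_eq_one (congrArg Subtype.val hj)
  exact hy1 (orderOf_eq_one_iff.1
    (Nat.eq_one_of_dvd_coprimes (Nat.coprime_pow_primes k j hp.out hq.out hpq) h1 h2))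

section

variable {M : Type*} [Group M] [Finite M] {A : Subgroup M} [A.Normal] {p q : ℕ}
  [hp : Fact p.Prime] [hq : Fact q.Prime]

/-- The index of `A` is not divisible by `p ^ 2`. -/
theorem Subgroup.not_sq_dvd_index (hpq : p ≠ q) (hqA : q ∣ Nat.card A)
    (hexp : ∀ (x : M) (k : ℕ), x ^ p ^ k = 1 → x ^ p = 1)
    (hcom : ∀ y ∈ A, y ≠ 1 → ∀ z, Commute y z → orderOf z ≠ orderOf y → z ∈ A) :
    ¬p ^ 2 ∣ A.index := by
  intro hsq
  obtain ⟨R⟩ : Nonempty (Sylow q A) := inferInstance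
  obtain ⟨T, hT, hTR, hTA⟩ := R.exists_le_normalizer_pow_dvd_relIndex p
  set R' := (R : Subgroup A).map A.subtype
  have hR' : IsPGroup q R' := R.isPGroup'.map _
  have hRA : R' ≤ A := Subgroup.map_subtype_le _
  obtain ⟨K, hKn, hBK, hKtop⟩ := Subgroup.exists_normal_lt hT (B := A.subgroupOf T) (hTA 2 hsq)
  set V : Subgroup M := R' ⊓ Subgroup.centralizer R'
  have hTV : T ≤ Subgroup.normalizer (V : Set M) :=
    hTR.trans R'.normalizer_le_normalizer_inf_centralizer
  have hV : IsPGroup q V := hR'.to_le inf_le_left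
  obtain ⟨v, hv⟩ : ∃ v : V, v ≠ 1 := by
    have : Nontrivial R' := by
      rw [← Finite.one_lt_card_iff_nontrivial, Subgroup.card_map_of_injective A.subtype_injective]
      rw [R.card_eq_multiplicity]
      exact Nat.one_lt_pow (hq.out.factorization_pos_of_dvd Nat.card_pos.ne' hqA).ne' hq.out.one_lt
    have := hR'.center_nontrivial
    obtain ⟨⟨z, hz⟩, hz1⟩ := exists_ne (1 : Subgroup.center R')
    refine ⟨⟨z, z.2, Subgroup.mem_centralizer_iff.2 fun r hr =>
      congrArg Subtype.val (Subgroup.mem_center_iff.1 hz ⟨r, hr⟩)⟩, fun h => hz1 ?_⟩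
    exact Subtype.ext (Subtype.ext (congrArg (Subtype.val (p := (· ∈ V))) h))
  let φ : T →* MulAut V := V.normalizerMonoidHom.comp (Subgroup.inclusion hTV)
  have hφ : ∀ (t : T) (w : V), φ t w = w ↔ Commute (w : M) t := by
    intro t w
    rw [Subtype.ext_iff, show (φ t w : M) = t * w * (t : M)⁻¹ from rfl, mul_inv_eq_iff_eq_mul]
    exact ⟨fun h => h.symm, fun h => h.symm⟩
  have hfix : ∀ (t : T) (w : V), w ≠ 1 → φ t w = w → (t : M) ∈ A := by
    intro t w hw h
    have hw1 : (w : M) ≠ 1 := fun h => hw (Subtype.ext h)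
    exact hcom w (hRA w.2.1) hw1 t ((hφ t w).1 h) (hT.orderOf_ne hpq hR' t.2 w.2.1 hw1)
  refine hBK.not_ge fun k hk => hfix k v hv ?_
  refine MulAut.apply_eq_of_forall_notMem (p := p) (fun a b => ?_) (fun y => ?_) φ K hKtop ?_ ?_
    hk v
  · exact Subtype.ext (Subgroup.mem_centralizer_iff.1 b.2.2 a a.2.1)
  · obtain ⟨k, hk⟩ := hT y
    exact Subtype.ext (hexp y k (congrArg Subtype.val hk))
  · intro y hy w hw
    by_contra hw1
    exact hy (hBK.le (hfix y w hw1 hw))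
  · obtain ⟨a, ha⟩ := IsPGroup.iff_card.1 hV
    obtain ⟨b, hb⟩ := IsPGroup.iff_card.1 (hT.to_subgroup K)
    rw [ha, hb]
    exact Nat.coprime_pow_primes _ _ hq.out hp.out hpq.symm

theorem Subgroup.pow_factorization_modEq_one (hpq : p ≠ q) (hpA : p ∣ A.index)
    (hcom : ∀ y ∈ A, y ≠ 1 → ∀ z, Commute y z → orderOf z ≠ orderOf y → z ∈ A) :
    q ^ (Nat.card A).factorization q ≡ 1 [MOD p] := by
  obtain ⟨R⟩ : Nonempty (Sylow q A) := inferInstance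
  obtain ⟨T, hT, hTR, hTA⟩ := R.exists_le_normalizer_pow_dvd_relIndex p
  set R' := (R : Subgroup A).map A.subtype
  have hR' : IsPGroup q R' := R.isPGroup'.map _
  have hRA : R' ≤ A := Subgroup.map_subtype_le _
  obtain ⟨t, htT, htA⟩ : ∃ t ∈ T, t ∉ A := by
    by_contra! hcon
    have := hTA 1 (by simpa using hpA)
    rw [Subgroup.relIndex_eq_one.2 hcon, pow_one, Nat.dvd_one] at this
    exact hp.out.ne_one this
  let _ : MulAction T R' := MulAction.compHom R' (Subgroup.inclusion hTR)
  have h1 := hT.card_modEq_card_fixedPoints R'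
  rw [Subgroup.card_map_of_injective A.subtype_injective, R.card_eq_multiplicity] at h1
  suffices h2 : MulAction.fixedPoints T R' = {1} by
    rwa [h2, Nat.card_coe_set_eq, Set.ncard_singleton] at h1
  ext w
  rw [Set.mem_singleton_iff]
  constructor
  · intro hw
    by_contra hw1
    have hw1' : (w : M) ≠ 1 := fun h => hw1 (Subtype.ext h)
    have h3 : t * w * t⁻¹ = w := congrArg Subtype.val (hw ⟨t, htT⟩)
    exact htA (hcom w (hRA w.2) hw1' t (mul_inv_eq_iff_eq_mul.1 h3).symm
      (hT.orderOf_ne hpq hR' htT w.2 hw1'))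
  · rintro rfl t
    refine Subtype.ext ?_
    change (t : M) * 1 * (t : M)⁻¹ = 1
    simp

theorem Subgroup.pow_factorization_index_dvd (hpq : p ≠ q)
    (hpA : (Nat.card A).factorization p = 1)
    (hcom : ∀ y ∈ A, y ≠ 1 → ∀ z, Commute y z → orderOf z ≠ orderOf y → z ∈ A) :
    q ^ A.index.factorization q ∣ p - 1 := by
  obtain ⟨R⟩ : Nonempty (Sylow p A) := inferInstance
  obtain ⟨T, hT, hTR, hTA⟩ := R.exists_le_normalizer_pow_dvd_relIndex q
  set R' := (R : Subgroup A).map A.subtype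
  have hR' : IsPGroup p R' := R.isPGroup'.map _
  have hRA : R' ≤ A := Subgroup.map_subtype_le _
  have hcard : Nat.card R' = p := by
    rw [Subgroup.card_map_of_injective A.subtype_injective, R.card_eq_multiplicity, hpA, pow_one]
  have := isCyclic_of_prime_card hcard
  obtain ⟨v, hv⟩ : ∃ v : R', v ≠ 1 := by
    have : Nontrivial R' := by
      rw [← Finite.one_lt_card_iff_nontrivial, hcard]
      exact hp.out.one_lt
    exact exists_ne 1
  let φ : T →* MulAut R' := R'.normalizerMonoidHom.comp (Subgroup.inclusion hTR)
  have hker : φ.ker ≤ A.subgroupOf T := by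
    intro t ht
    have hv1 : (v : M) ≠ 1 := fun h => hv (Subtype.ext h)
    have h1 : (t : M) * v * (t : M)⁻¹ = v :=
      congrArg Subtype.val (DFunLike.congr_fun (MonoidHom.mem_ker.1 ht) v)
    exact hcom v (hRA v.2) hv1 t (mul_inv_eq_iff_eq_mul.1 h1).symm
      (hT.orderOf_ne hpq.symm hR' t.2 v.2 hv1)
  refine (hTA _ (Nat.ordProj_dvd _ _)).trans ((Subgroup.index_dvd_of_le hker).trans ?_)
  rw [Subgroup.index_ker, ← Nat.totient_prime hp.out, ← hcard, ← IsCyclic.card_mulAut]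
  exact Subgroup.card_subgroup_dvd_card _

end

theorem Subgroup.card_mul_card_le_of_disjoint {G : Type*} [Group G] [Finite G] {H K L : Subgroup G}
    (hH : H ≤ L) (hK : K ≤ L) (h : Disjoint H K) : Nat.card H * Nat.card K ≤ Nat.card L := by
  rw [← Nat.card_prod]
  refine Nat.card_le_card_of_injective
    (fun x : H × K => (⟨x.1 * x.2, L.mul_mem (hH x.1.2) (hK x.2.2)⟩ : L)) fun x y hxy => ?_
  exact Subgroup.mul_injective_of_disjoint h (congrArg Subtype.val hxy)

/-- A Sylow subgroup of the normalizer of `A` contains a large part of `A`. -/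
theorem Subgroup.exists_card_eq_le_normalizer {G : Type*} [Group G] [Finite G] (A : Subgroup G)
    (l : ℕ) [hl : Fact l.Prime] : ∃ S ≤ Subgroup.normalizer (A : Set G),
      Nat.card S = l ^ (Nat.card (Subgroup.normalizer (A : Set G))).factorization l ∧
      l ^ (Nat.card A).factorization l ≤ Nat.card (A ⊓ S : Subgroup G) := by
  set M := Subgroup.normalizer (A : Set G)
  obtain ⟨S⟩ : Nonempty (Sylow l M) := inferInstance
  refine ⟨(S : Subgroup M).map M.subtype, Subgroup.map_subtype_le _, ?_, ?_⟩
  · rw [Subgroup.card_map_of_injective M.subtype_injective, S.card_eq_multiplicity]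
  · have h1 := Nat.le_of_dvd Nat.card_pos (S.pow_factorization_dvd_card_inf (A.subgroupOf M))
    rw [Nat.card_congr (Subgroup.subgroupOfEquivOfLe A.le_normalizer).toEquiv] at h1
    refine h1.trans ?_
    rw [← Subgroup.card_map_of_injective M.subtype_injective]
    refine Subgroup.card_le_of_le ?_
    rintro _ ⟨s, ⟨hsA, hsS⟩, rfl⟩
    exact ⟨hsA, s, hsS, rfl⟩

theorem Subgroup.two_mul_factorization_le {G : Type*} [Group G] [Finite G] {A : Subgroup G}
    (hTI : ∀ g, ∀ y ∈ A, y ≠ 1 → g * y * g⁻¹ ∈ A → g ∈ Subgroup.normalizer (A : Set G))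
    {l : ℕ} [hl : Fact l.Prime]
    (hlt : (Nat.card (Subgroup.normalizer (A : Set G))).factorization l <
      (Nat.card G).factorization l) :
    2 * (Nat.card A).factorization l ≤
      (Nat.card (Subgroup.normalizer (A : Set G))).factorization l := by
  obtain ⟨S, hSM, hS, hSA⟩ := A.exists_card_eq_le_normalizer l
  set M := Subgroup.normalizer (A : Set G)
  obtain ⟨K, hK, hSK⟩ := Sylow.exists_subgroup_card_pow_succ
    ((hl.out.pow_dvd_iff_le_factorization Nat.card_pos.ne').2 hlt) hS
  have hidx : (S.subgroupOf K).index = (Nat.card K).minFac := by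
    rw [hK, hl.out.pow_minFac (by omega)]
    have h1 := (S.subgroupOf K).card_mul_index
    rw [Nat.card_congr (Subgroup.subgroupOfEquivOfLe hSK).toEquiv, hS, hK, pow_succ] at h1
    exact Nat.eq_of_mul_eq_mul_left (pow_pos hl.out.pos _) h1
  have := Subgroup.normal_of_index_eq_minFac_card hidx
  have hKS := Subgroup.le_normalizer_of_normal_subgroupOf hSK
  obtain ⟨y, hyK, hyM⟩ : ∃ y ∈ K, y ∉ M := by
    by_contra! hcon
    have h1 := Subgroup.card_dvd_of_le hcon
    rw [hK, hl.out.pow_dvd_iff_le_factorization Nat.card_pos.ne'] at h1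
    omega
  set D := A ⊓ S
  have hD : D.map (MulAut.conj y).toMonoidHom ≤ S := by
    rintro _ ⟨d, hd, rfl⟩
    exact (Subgroup.mem_normalizer_iff.1 (hKS hyK) d).1 hd.2
  have hdisj : Disjoint D (D.map (MulAut.conj y).toMonoidHom) := by
    rw [Subgroup.disjoint_def]
    rintro _ hd ⟨e, he, rfl⟩
    by_contra hne
    refine hyM (hTI y e he.1 ?_ hd.1)
    rintro rfl
    exact hne (map_one _)
  have h1 := Subgroup.card_mul_card_le_of_disjoint inf_le_right hD hdisj
  rw [Subgroup.card_map_of_injective (MulAut.conj y).injective, hS] at h1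
  have h2 := (Nat.mul_le_mul hSA hSA).trans h1
  rw [← pow_add, Nat.pow_le_pow_iff_right hl.out.one_lt] at h2
  omega

namespace IsEqualPartition

variable {G : Type*} [Group G] [Finite G] {C : Finset (Subgroup G)}

/-- Elements of order `p` and of another prime order do not commute, if the `p`-part of the order
of the components of an equal partition is small. -/
theorem eq_of_commute (hC : IsEqualPartition C) {p q : ℕ} [hp : Fact p.Prime] [hq : Fact q.Prime]
    {H : Subgroup G} (hH : H ∈ C)
    (hgood : 2 * (Nat.card H).factorization p ≤ (Nat.card G).factorization p) {x y : G}
    (hxy : Commute x y) (hx : orderOf x = p) (hy : orderOf y = q) : q = p := by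
  by_contra hqp
  have hx1 : x ≠ 1 := fun h => hp.out.one_lt.ne (by rw [← hx, h, orderOf_one])
  have hy1 : y ≠ 1 := fun h => hq.out.one_lt.ne (by rw [← hy, h, orderOf_one])
  have hpm := hC.isPartitionMap_core
  set A := core C x
  have hcore : ∀ z ∈ A, z ≠ 1 → core C z = A := fun z hz hz1 => hpm.eq_of_mem x z hx1 hz1 hz
  have hxA : x ∈ A := hpm.mem x
  have hyA : y ∈ A := by
    by_contra h
    exact hqp (hy ▸ hx ▸ (hpm.orderOf_eq_of_commute hxy hx1 hy1 h).symm)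
  have hpA : p ∣ Nat.card A := hx ▸ Subgroup.orderOf_dvd_natCard A hxA
  have hqA : q ∣ Nat.card A := hy ▸ Subgroup.orderOf_dvd_natCard A hyA
  have hAm : Nat.card A ∣ Nat.card H := by
    obtain ⟨K, hK, hxK⟩ := hC.1.2 x
    rw [hC.2.1 H hH K hK]
    exact Subgroup.card_dvd_of_le fun z hz => by simpa using hz 1 K hK (by simpa using hxK)
  have hfac : ∀ l, (Nat.card A).factorization l ≤ (Nat.card H).factorization l := fun l =>
    (Nat.factorization_le_iff_dvd Nat.card_pos.ne' Nat.card_pos.ne').2 hAm l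
  have hTI : ∀ g, ∀ z ∈ A, z ≠ 1 → g * z * g⁻¹ ∈ A → g ∈ Subgroup.normalizer (A : Set G) :=
    fun g z hz hz1 hg => hC.mem_normalizer_core hx1 hz1 hz hg
  have hcom : ∀ z ∈ A, z ≠ 1 → ∀ w, Commute z w → orderOf w ≠ orderOf z → w ∈ A := by
    intro z hz hz1 w hzw hne
    by_contra hw
    have hw1 : w ≠ 1 := fun h => hw (h ▸ A.one_mem)
    exact hne (hpm.orderOf_eq_of_commute hzw hz1 hw1 (hcore z hz hz1 ▸ hw)).symm
  have hTIl : ∀ l : ℕ, l.Prime → _ := fun l hl =>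
    have : Fact l.Prime := ⟨hl⟩
    Subgroup.two_mul_factorization_le hTI (l := l)
  obtain ⟨S, hSM, hS, hSA⟩ := A.exists_card_eq_le_normalizer q
  set M := Subgroup.normalizer (A : Set G)
  let B := A.subgroupOf M
  have hB : Nat.card B = Nat.card A :=
    Nat.card_congr (Subgroup.subgroupOfEquivOfLe A.le_normalizer).toEquiv
  have hMfac : ∀ l, (Nat.card M).factorization l =
      (Nat.card A).factorization l + B.index.factorization l := by
    intro l
    rw [← B.card_mul_index, Nat.factorization_mul Nat.card_pos.ne' B.index_ne_zero_of_finite,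
      Finsupp.add_apply, hB]
  have hMG : ∀ l, (Nat.card M).factorization l ≤ (Nat.card G).factorization l := fun l =>
    (Nat.factorization_le_iff_dvd Nat.card_pos.ne' Nat.card_pos.ne').2
      (Subgroup.card_subgroup_dvd_card M) l
  have hcomM : ∀ z ∈ B, z ≠ 1 → ∀ w, Commute z w → orderOf w ≠ orderOf z → w ∈ B :=
    fun z hz hz1 w hzw hne => hcom z hz (fun h => hz1 (Subtype.ext h)) w
      (congrArg Subtype.val hzw.eq) (by rwa [Subgroup.orderOf_coe, Subgroup.orderOf_coe])
  have hsq : ¬p ^ 2 ∣ B.index := by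
    refine Subgroup.not_sq_dvd_index (Ne.symm hqp) (hB ▸ hqA) (fun z k hz => Subtype.ext ?_) hcomM
    exact hC.pow_eq_one hH hgood (congrArg Subtype.val hz)
  rw [hp.out.pow_dvd_iff_le_factorization B.index_ne_zero_of_finite] at hsq
  have hpA1 := hp.out.factorization_pos_of_dvd Nat.card_pos.ne' hpA
  have hqA1 := hq.out.factorization_pos_of_dvd Nat.card_pos.ne' hqA
  have h1 := hMfac p
  have h2 := hMG p
  have h3 := hTIl p hp.out
  have h4 := hfac p
  have hA1 : (Nat.card A).factorization p = 1 := by omega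
  have hB1 : B.index.factorization p = 1 := by omega
  have hmod := Subgroup.pow_factorization_modEq_one (Ne.symm hqp)
    (Nat.dvd_of_factorization_pos (by omega : B.index.factorization p ≠ 0)) hcomM
  have hdvd := Subgroup.pow_factorization_index_dvd (Ne.symm hqp) (hB ▸ hA1) hcomM
  rw [hB] at hmod
  have hlt : B.index.factorization q < (Nat.card A).factorization q := by
    rw [← Nat.pow_lt_pow_iff_right hq.out.one_lt]
    have h5 := Nat.le_of_dvd (Nat.sub_pos_of_lt hp.out.one_lt) hdvd
    have h6 := (Nat.modEq_iff_dvd' (Nat.one_le_pow _ _ hq.out.pos)).1 hmod.symm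
    have h7 := Nat.one_lt_pow hqA1.ne' hq.out.one_lt
    have h8 := Nat.le_of_dvd (Nat.sub_pos_of_lt h7) h6
    have := hp.out.pos
    omega
  have h5 := hMfac q
  have h6 := hMG q
  have h7 := hTIl q hq.out
  have hSylow : (Nat.card M).factorization q = (Nat.card G).factorization q := by omega
  obtain ⟨K, hK, hKx⟩ := hC.exists_forall_conj_notMem hx1
  rw [hSylow] at hS
  let P := Sylow.ofCard S hS
  obtain ⟨T⟩ : Nonempty (Sylow q K) := inferInstance
  obtain ⟨Q, hQ⟩ := (T.isPGroup'.map K.subtype).exists_le_sylow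
  obtain ⟨g, hg⟩ := MulAction.exists_smul_eq G Q P
  let T' := ((T : Subgroup K).map K.subtype).map (MulAut.conj g).toMonoidHom
  have hT'S : T' ≤ S := by
    have hQS : ((g • Q : Sylow q G) : Subgroup G) = S := congrArg Sylow.toSubgroup hg
    rintro _ ⟨u, hu, rfl⟩
    rw [← hQS]
    exact ⟨u, hQ hu, rfl⟩
  have hT' : q ^ (Nat.card A).factorization q ≤ Nat.card T' := by
    rw [Subgroup.card_map_of_injective (MulAut.conj g).injective,
      Subgroup.card_map_of_injective K.subtype_injective, T.card_eq_multiplicity,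
      hC.2.1 K hK H hH]
    exact Nat.pow_le_pow_right hq.out.pos (hfac q)
  have hdisj : Disjoint (A ⊓ S) T' := by
    rw [Subgroup.disjoint_def]
    rintro _ ⟨hzA, -⟩ ⟨_, ⟨t, -, rfl⟩, rfl⟩
    by_contra hne
    refine hKx g⁻¹ ?_
    have h8 := hC.mem_core_symm hne hzA g⁻¹ K hK
    exact h8 (by simp [mul_assoc])
  have h8 := (Nat.mul_le_mul hSA hT').trans
    (Subgroup.card_mul_card_le_of_disjoint inf_le_right hT'S hdisj)
  rw [hS, ← pow_add, Nat.pow_le_pow_iff_right hq.out.one_lt] at h8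
  omega

end IsEqualPartition

theorem IsEqualPartition.exists_prime {G : Type*} [Group G] [Finite G] {C : Finset (Subgroup G)}
    (hC : IsEqualPartition C) :
    ¬IsCyclic G ∧ ∃ p : ℕ, p.Prime ∧ IsPGroup p G ∧ Monoid.exponent G = p := by
  obtain ⟨H, hH, -⟩ := hC.1.2 1
  have hm := hC.one_lt_card hH
  obtain ⟨p, hp, hpH, hgood⟩ := Nat.exists_prime_two_mul_factorization_le hm
    (Subgroup.card_subgroup_dvd_card H) (hC.sq_card_le hH) fun q hq hqG => by
      have : Fact q.Prime := ⟨hq⟩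
      obtain ⟨x, hx⟩ := exists_prime_orderOf_dvd_card' q hqG
      obtain ⟨K, hK, hxK⟩ := hC.1.2 x
      rw [hC.2.1 H hH K hK, ← hx]
      exact Subgroup.orderOf_dvd_natCard K hxK
  have : Fact p.Prime := ⟨hp⟩
  have hexp : ∀ (x : G) (k : ℕ), x ^ p ^ k = 1 → x ^ p = 1 := fun _ _ hx =>
    hC.pow_eq_one hH hgood hx
  have hG : IsPGroup p G := hC.isPGroup (hpH.trans (Subgroup.card_subgroup_dvd_card H)) hexp
    fun x y q hq hxy hx hy => have : Fact q.Prime := ⟨hq⟩; hC.eq_of_commute hH hgood hxy hx hy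
  have hdvd : Monoid.exponent G ∣ p := Monoid.exponent_dvd_of_forall_pow_eq_one fun x => by
    obtain ⟨k, hk⟩ := hG x
    exact hexp x k hk
  refine ⟨fun hcyc => ?_, p, hp, hG, ?_⟩
  · rw [IsCyclic.exponent_eq_card] at hdvd
    exact (Nat.le_of_dvd hp.pos hdvd).not_gt
      ((Nat.le_of_dvd Nat.card_pos hpH).trans_lt (hC.card_lt hH))
  · refine (hp.eq_one_or_self_of_dvd _ hdvd).resolve_left fun h => ?_
    have := Monoid.exp_eq_one_iff.1 h
    have h1 := hC.card_lt hH
    exact (Finite.card_le_one_iff_subsingleton.2 this).not_gt (hm.trans h1)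

/-- In a noncyclic group of prime exponent the subgroups of prime order form an equal partition. -/
theorem exists_isEqualPartition {G : Type*} [Group G] [Finite G] (hG : ¬IsCyclic G) {p : ℕ}
    (hp : p.Prime) (hexp : Monoid.exponent G = p) :
    ∃ C : Finset (Subgroup G), IsEqualPartition C := by
  have hord : ∀ g : G, g ≠ 1 → orderOf g = p := fun g hg =>
    have : Fact p.Prime := ⟨hp⟩
    orderOf_eq_prime (hexp ▸ Monoid.pow_exponent_eq_one g) hg
  let s : Set (Subgroup G) := {H | ∃ g : G, g ≠ 1 ∧ Subgroup.zpowers g = H}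
  have hs : ∀ H, H ∈ s.toFinite.toFinset ↔ ∃ g : G, g ≠ 1 ∧ Subgroup.zpowers g = H := fun H =>
    s.toFinite.mem_toFinset
  have hcard : ∀ H ∈ s.toFinite.toFinset, Nat.card H = p := by
    intro H hH
    obtain ⟨g, hg, rfl⟩ := (hs H).1 hH
    rw [Nat.card_zpowers, hord g hg]
  refine ⟨s.toFinite.toFinset, ⟨fun H hH htop => ?_, fun g => ?_⟩, fun H hH K hK => ?_,
    fun H hH K hK hne => ?_⟩
  · obtain ⟨g, -, rfl⟩ := (hs H).1 hH
    exact hG ⟨g, (Subgroup.eq_top_iff' _).1 htop⟩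
  · by_cases hg : g = 1
    · obtain ⟨x, hx⟩ : ∃ x : G, x ≠ 1 := by
        by_contra! h
        exact hG ⟨1, fun x => by rw [h x]; exact ⟨0, zpow_zero _⟩⟩
      exact ⟨_, (hs _).2 ⟨x, hx, rfl⟩, hg ▸ one_mem _⟩
    · exact ⟨_, (hs _).2 ⟨g, hg, rfl⟩, Subgroup.mem_zpowers g⟩
  · rw [hcard H hH, hcard K hK]
  · have h1 := hcard H hH
    by_contra hbot
    refine hne ?_
    have h2 : Nat.card (H ⊓ K : Subgroup G) ∣ p := h1 ▸ Subgroup.card_dvd_of_le inf_le_left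
    have h3 := (hp.eq_one_or_self_of_dvd _ h2).resolve_left fun h =>
      hbot (Subgroup.card_eq_one.1 h)
    exact (Subgroup.eq_of_le_of_card_ge inf_le_left (by rw [h1, h3])).symm.trans
      (Subgroup.eq_of_le_of_card_ge inf_le_right (by rw [hcard K hK, h3]))

/-- A finite group `G` has an equal partition if and only if `G` is a non-cyclic
`p`-group of exponent `p` for some prime `p`. -/
theorem equal_partition_iff (G : Type*) [Group G] [Finite G] :
    (∃ C : Finset (Subgroup G), IsEqualPartition C) ↔
      ¬IsCyclic G ∧ ∃ p : ℕ, p.Prime ∧ IsPGroup p G ∧ Monoid.exponent G = p := by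
  constructor
  · rintro ⟨C, hC⟩
    exact hC.exists_prime
  · rintro ⟨hG, p, hp, -, hexp⟩
    exact exists_isEqualPartition hG hp hexp
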